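/- There is a universal constant C > 0 such that for every real β ≥ 1 and every sufficiently large integer k the following holds: for every function c mapping each finite set V ⊆ ℝ^k to a subset c(V) ⊆ V with |c(V)| ≤ k^β, there exist finitely many finite sets V_1, …, V_p ⊆ ℝ^k such that, writing OPT for the max over subsets S ⊆ V_1 ∪ … ∪ V_p with |S| = k of det_k( Σ_{v∈S} v vᵀ ) and OPT_c for the max over subsets S ⊆ c(V_1) ∪ … ∪ c(V_p) with |S| = k of det_k( Σ_{v∈S} v vᵀ ), one has OPT > 0 and OPT_c ≤ (C·β·log² k / k)^{k − ⌈k/log k⌉} · OPT. Consequently, any composable core-set of size at most k^β for the k-determinant maximization problem incurs an approximation factor of at least (k/β)^{k(1−o(1))}. -/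

import Mathlib

/-!
STATEMENT 19: There is a universal constant C > 0 such that for every β ≥ 1 and
every sufficiently large k the following holds: for every function c mapping finite
sets V ⊆ ℝ^k to subsets c(V) ⊆ V with |c(V)| ≤ k^β, there exist finitely many
finite sets V_1, …, V_p ⊆ ℝ^k such that, writing OPT for the max of
det_k( Σ_{v∈S} v vᵀ ) over size-k subsets S of V_1 ∪ … ∪ V_p and OPT_c for the
analogous max over size-k subsets of c(V_1) ∪ … ∪ c(V_p), one has OPT > 0 and
OPT_c ≤ (C·β·log² k / k)^{k − ⌈k/log k⌉} · OPT.

OPT is encoded by a maximizing subset S₀ (a size-k subset of the union whose value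
dominates that of every size-k subset); OPT_c ≤ factor·OPT is encoded by bounding
the value of every size-k subset T of the union of the core-sets.
-/

open Matrix Finset

noncomputable section

/-- The outer product `v vᵀ` as a `k × k` real matrix. -/
def outer {k : ℕ} (v : Fin k → ℝ) : Matrix (Fin k) (Fin k) ℝ := Matrix.vecMulVec v v

/-- `detk k A` is the sum of all `k × k` principal minors of `A`. -/
def detk {d : ℕ} (k : ℕ) (A : Matrix (Fin d) (Fin d) ℝ) : ℝ :=
  ∑ S ∈ Finset.powersetCard k (Finset.univ : Finset (Fin d)),
    Matrix.det (A.submatrix (fun i : {x // x ∈ S} => (i : Fin d))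
      (fun j : {x // x ∈ S} => (j : Fin d)))


lemma detk_eq_det {k : ℕ} (A : Matrix (Fin k) (Fin k) ℝ) : detk k A = A.det := by
  unfold detk
  have h : Finset.powersetCard k (Finset.univ : Finset (Fin k)) = {Finset.univ} := by
    have := Finset.powersetCard_self (Finset.univ : Finset (Fin k))
    simpa using this
  rw [h, Finset.sum_singleton]
  exact Matrix.det_submatrix_equiv_self
    (Equiv.subtypeUnivEquiv (fun x => Finset.mem_univ x) : {x // x ∈ (Finset.univ : Finset (Fin k))} ≃ Fin k) A

lemma detk_image {k : ℕ} (v : Fin k → (Fin k → ℝ)) (hv : Function.Injective v)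
    (S : Finset (Fin k → ℝ)) (hS : S = Finset.univ.image v) :
    detk k (∑ w ∈ S, outer w) = (Matrix.of v).det ^ 2 := by
  rw [detk_eq_det, hS, Finset.sum_image (fun a _ b _ h => hv h)]
  have : ∑ x, outer (v x) = (Matrix.of v)ᵀ * Matrix.of v := by
    ext i j
    simp [outer, Matrix.sum_apply, Matrix.mul_apply, Matrix.vecMulVec_apply]
  rw [this, Matrix.det_mul, Matrix.det_transpose, sq]

lemma exists_enum {k : ℕ} (S : Finset (Fin k → ℝ)) (hS : S.card = k) :
    ∃ v : Fin k → (Fin k → ℝ), Function.Injective v ∧ S = Finset.univ.image v := by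
  let f := (S.equivFinOfCardEq hS).symm
  refine ⟨fun i => (f i : Fin k → ℝ), fun a b h => f.injective (Subtype.ext h), ?_⟩
  ext w
  simp only [Finset.mem_image, Finset.mem_univ, true_and]
  constructor
  · intro hw
    exact ⟨f.symm ⟨w, hw⟩, by simp⟩
  · rintro ⟨a, rfl⟩
    exact (f a).2

/-- bound for the sheared matrices -/
lemma det_bound_aux {m e : ℕ} (N : Matrix (Fin m ⊕ Fin e) (Fin m ⊕ Fin e) ℝ) (t : ℝ)
    (ι : Fin m ⊕ Fin e → Fin e)
    (h1 : ∀ r j, |N r (Sum.inl j)| ≤ 1)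
    (h2 : ∀ r l, l ≠ ι r → N r (Sum.inr l) = 0)
    (h3 : ∀ r l, |N r (Sum.inr l)| ≤ t) :
    |N.det| ≤ ((m + e : ℕ) : ℝ) ^ m * t ^ e := by
  classical
  let good : Finset (Equiv.Perm (Fin m ⊕ Fin e)) :=
    Finset.univ.filter (fun σ => ∀ l, ι (σ (Sum.inr l)) = l)
  have hcard : good.card ≤ (m + e) ^ m := by
    have : good.card ≤ (Finset.univ : Finset (Fin m → Fin m ⊕ Fin e)).card := by
      apply Finset.card_le_card_of_injOn (fun σ j => σ (Sum.inl j)) (fun _ _ => Finset.mem_coe.2 (Finset.mem_univ _))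
      intro σ hσ τ hτ h
      simp only [good, Finset.coe_filter, Finset.mem_univ, true_and, Set.mem_ofPred_eq] at hσ hτ
      have hl : ∀ j, σ (Sum.inl j) = τ (Sum.inl j) := fun j => congrFun h j
      ext1 c
      rcases c with j | l
      · exact hl j
      · obtain ⟨c', hc'⟩ := τ.surjective (σ (Sum.inr l))
        rcases c' with j | l'
        · rw [← hl j] at hc'
          exact absurd (σ.injective hc') (by simp)
        · have h5 := hτ l'
          rw [hc', hσ l] at h5
          subst h5
          exact hc'.symm
    simpa using this
  have ht : ∀ σ ∈ good, |∏ c, N (σ c) c| ≤ t ^ e := by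
    intro σ _
    rw [Finset.abs_prod, Fintype.prod_sum_type]
    have a1 : ∏ j, |N (σ (Sum.inl j)) (Sum.inl j)| ≤ 1 :=
      Finset.prod_le_one (fun _ _ => abs_nonneg _) (fun j _ => h1 _ _)
    have a2 : ∏ l, |N (σ (Sum.inr l)) (Sum.inr l)| ≤ t ^ e := by
      calc _ ≤ ∏ _l : Fin e, t := Finset.prod_le_prod (fun _ _ => abs_nonneg _) (fun l _ => h3 _ _)
        _ = t ^ e := by simp
    calc _ ≤ 1 * ∏ l, |N (σ (Sum.inr l)) (Sum.inr l)| :=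
          mul_le_mul_of_nonneg_right a1 (Finset.prod_nonneg (fun _ _ => abs_nonneg _))
      _ ≤ t ^ e := by rw [one_mul]; exact a2
  have hz : ∀ σ, σ ∉ good → |∏ c, N (σ c) c| = 0 := by
    intro σ hσ
    simp only [good, Finset.mem_filter, Finset.mem_univ, true_and, not_forall] at hσ
    obtain ⟨l, hl⟩ := hσ
    rw [abs_eq_zero]
    exact Finset.prod_eq_zero (Finset.mem_univ (Sum.inr l)) (h2 _ _ (fun h => hl h.symm))
  have hte : 0 ≤ t ^ e := by
    rcases Nat.eq_zero_or_pos e with h | h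
    · subst h; simp
    · have : 0 ≤ t := (abs_nonneg _).trans (h3 (Sum.inr ⟨0, h⟩) ⟨0, h⟩)
      positivity
  calc |N.det| ≤ ∑ σ : Equiv.Perm (Fin m ⊕ Fin e), |∏ c, N (σ c) c| := by
        rw [Matrix.det_apply']
        refine (Finset.abs_sum_le_sum_abs _ _).trans (Finset.sum_le_sum fun σ _ => ?_)
        rw [abs_mul]
        rcases Int.units_eq_one_or (Equiv.Perm.sign σ) with h | h <;> simp [h]
    _ = ∑ σ ∈ good, |∏ c, N (σ c) c| := by
        symm
        exact Finset.sum_subset (Finset.subset_univ _) (fun σ _ h => hz σ h)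
    _ ≤ ∑ σ ∈ good, t ^ e := Finset.sum_le_sum ht
    _ = good.card * t ^ e := by simp
    _ ≤ _ := by
        gcongr
        exact_mod_cast hcard

/-- The shear matrix. -/
def shear {m e : ℕ} (Z : Fin e → Fin m → ℤ) : Matrix (Fin m ⊕ Fin e) (Fin m ⊕ Fin e) ℝ :=
  Matrix.fromBlocks 1 (Matrix.of fun j l => (Z l j : ℝ)) 0 1

lemma det_shear {m e : ℕ} (Z : Fin e → Fin m → ℤ) : (shear Z).det = 1 := by
  simp [shear]

/-- coordinates `(y, Z y + s e_i)` -/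
def svec {m e k : ℕ} (φ : Fin k ≃ Fin m ⊕ Fin e) (Z : Fin e → Fin m → ℤ) (y : Fin m → ℤ) :
    Fin k → ℝ :=
  fun a => Sum.elim (fun j => (y j : ℝ)) (fun l => ((Z l ⬝ᵥ y : ℤ) : ℝ)) (φ a)

lemma svec_inj {m e k : ℕ} (φ : Fin k ≃ Fin m ⊕ Fin e) (Z : Fin e → Fin m → ℤ) :
    Function.Injective (svec φ Z) := by
  intro y y' h
  ext j
  have := congrFun h (φ.symm (Sum.inl j))
  simpa [svec] using this

/-- row in sheared coordinates -/
def srow {m e : ℕ} (y : Fin m → ℤ) (w : Fin e → ℤ) : Fin m ⊕ Fin e → ℝ :=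
  Sum.elim (fun j => (y j : ℝ)) (fun l => (w l : ℝ))

lemma det_shear_eq {m e k : ℕ} (φ : Fin k ≃ Fin m ⊕ Fin e) (Z : Fin e → Fin m → ℤ)
    (Y : Fin k → Fin m → ℤ) (Z' : Fin k → Fin e → Fin m → ℤ) :
    (Matrix.of fun r => svec φ (Z' r) (Y r)).det =
      (Matrix.of fun r => srow (Y (φ.symm r)) (fun l => (Z' (φ.symm r) l - Z l) ⬝ᵥ Y (φ.symm r))).det := by
  rw [← Matrix.det_submatrix_equiv_self φ.symm]
  have : (Matrix.of fun r => svec φ (Z' r) (Y r)).submatrix φ.symm φ.symm =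
      (Matrix.of fun r => srow (Y (φ.symm r))
        (fun l => (Z' (φ.symm r) l - Z l) ⬝ᵥ Y (φ.symm r))) * shear Z := by
    ext r c
    rcases c with j | l
    · simp [svec, srow, shear, Matrix.mul_apply, Fintype.sum_sum_type, Matrix.one_apply]
    · simp [svec, srow, shear, Matrix.mul_apply, Fintype.sum_sum_type, Matrix.one_apply,
        dotProduct]
      rw [← Finset.sum_add_distrib]
      exact Finset.sum_congr rfl fun j _ => by ring
  rw [this, Matrix.det_mul, det_shear, mul_one]

/-- averaging -/
lemma averaging {m e : ℕ} (G : Finset (Fin m → ℤ)) (hG : ∀ x ∈ G, ∀ j, |x j| ≤ 1) (K : ℕ)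
    (L : (Fin e → Fin m → ℤ) → Finset (Fin m → ℤ)) (hL : ∀ Z, (L Z).card ≤ K)
    (hN : 2 * e * K < G.card) :
    ∃ Z : Fin e → Fin m → ℤ, ∀ i, ∃ x ∈ G, x ∉ L (Z + Pi.single i x) := by
  classical
  by_contra! hcon
  let box : ℕ → Finset (Fin e → Fin m → ℤ) := fun M =>
    Fintype.piFinset fun _ => Fintype.piFinset fun _ => Finset.Icc (-(M:ℤ)) M
  have hbox : ∀ M, (box M).card = (2 * M + 1) ^ (e * m) := by
    intro M
    have h0 : (((M:ℤ) + 1 + M).toNat) = 2 * M + 1 := by omega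
    simp only [box, Fintype.card_piFinset, Int.card_Icc, sub_neg_eq_add, Finset.prod_const, Finset.card_univ, Fintype.card_fin]
    rw [show ((M:ℤ) + 1 + M).toNat = 2 * M + 1 from h0]
    rw [← pow_mul, mul_comm m e]
  obtain ⟨ind, hind⟩ : ∃ ind : (Fin m → ℤ) → (Fin e → Fin m → ℤ) → ℕ,
      ∀ x Z, ind x Z = if x ∈ L Z then 1 else 0 := ⟨_, fun _ _ => rfl⟩
  have key : ∀ M, G.card * (box M).card ≤ e * K * (box (M+1)).card := by
    intro M
    calc G.card * (box M).card = ∑ Z ∈ box M, G.card := by simp [mul_comm]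
      _ ≤ ∑ Z ∈ box M, ∑ i : Fin e, ∑ x ∈ G, ind x (Z + Pi.single i x) := by
          refine Finset.sum_le_sum fun Z _ => ?_
          obtain ⟨i, hi⟩ := hcon Z
          calc G.card = ∑ x ∈ G, ind x (Z + Pi.single i x) := by
                rw [Finset.card_eq_sum_ones]
                exact Finset.sum_congr rfl fun x hx => by rw [hind, if_pos (hi x hx)]
            _ ≤ _ := Finset.single_le_sum (f := fun i => ∑ x ∈ G, ind x (Z + Pi.single i x))
                  (fun _ _ => Nat.zero_le _) (Finset.mem_univ i)
      _ = ∑ i : Fin e, ∑ x ∈ G, ∑ Z ∈ box M, ind x (Z + Pi.single i x) := by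
          rw [Finset.sum_comm]
          exact Finset.sum_congr rfl fun i _ => Finset.sum_comm
      _ ≤ ∑ i : Fin e, ∑ x ∈ G, ∑ Z ∈ box (M+1), ind x Z := by
          refine Finset.sum_le_sum fun i _ => Finset.sum_le_sum fun x hx => ?_
          have hs := Finset.sum_image (s := box M)
            (g := fun Z => Z + (Pi.single i x : Fin e → Fin m → ℤ))
            (f := ind x) (fun a _ b _ h => add_right_cancel h)
          rw [← hs]
          apply Finset.sum_le_sum_of_subset
          intro Z' hZ'
          obtain ⟨Z, hZ, rfl⟩ := Finset.mem_image.1 hZ'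
          simp only [box, Fintype.mem_piFinset, Finset.mem_Icc] at hZ ⊢
          intro a j
          have h1 := hZ a j
          have h2 := abs_le.1 (hG x hx j)
          by_cases hai : a = i
          · subst hai
            simp only [Pi.add_apply, Pi.single_eq_same]
            push_cast
            constructor <;> linarith [h1.1, h1.2, h2.1, h2.2]
          · simp only [Pi.add_apply, Pi.single_eq_of_ne hai]
            push_cast
            simp only [Pi.zero_apply]
            constructor <;> linarith [h1.1, h1.2]
      _ = ∑ i : Fin e, ∑ Z ∈ box (M+1), ∑ x ∈ G, ind x Z :=
          Finset.sum_congr rfl fun i _ => Finset.sum_comm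
      _ ≤ ∑ i : Fin e, ∑ Z ∈ box (M+1), K := by
          refine Finset.sum_le_sum fun i _ => Finset.sum_le_sum fun Z _ => ?_
          simp only [hind]
          rw [← Finset.card_filter]
          refine le_trans (Finset.card_le_card ?_) (hL Z)
          intro x hx
          exact (Finset.mem_filter.1 hx).2
      _ = e * K * (box (M+1)).card := by simp; ring
  -- ratio of the boxes
  set D := e * m with hD
  have hr : (2 * (2 * D + 1) + 1) ^ D ≤ 2 * (2 * (2 * D) + 1) ^ D := by
    have hb := one_add_mul_le_pow (a := -(2 / (4 * (D:ℝ) + 3))) (by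
      have : (2:ℝ) / (4 * (D:ℝ) + 3) ≤ 2 := by
        rw [div_le_iff₀ (by positivity)]
        have : (0:ℝ) ≤ D := Nat.cast_nonneg _
        nlinarith
      linarith) D
    have h1 : (1:ℝ) / 2 ≤ 1 + (D:ℝ) * -(2 / (4 * (D:ℝ) + 3)) := by
      have : (D:ℝ) * (2 / (4 * (D:ℝ) + 3)) ≤ 1 / 2 := by
        rw [← mul_div_assoc, div_le_div_iff₀ (by positivity) (by positivity)]
        linarith
      linarith
    have h2 : 1 + -(2 / (4 * (D:ℝ) + 3)) = (4 * (D:ℝ) + 1) / (4 * (D:ℝ) + 3) := by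
      field_simp; ring
    rw [h2, div_pow] at hb
    have h3 := h1.trans hb
    rw [div_le_div_iff₀ (by positivity) (by positivity)] at h3
    have h4 : ((2 * (2 * (D:ℝ) + 1) + 1)) ^ D ≤ 2 * (2 * (2 * (D:ℝ)) + 1) ^ D := by
      have e1 : 2 * (2 * (D:ℝ) + 1) + 1 = 4 * D + 3 := by ring
      have e2 : 2 * (2 * (D:ℝ)) + 1 = 4 * D + 1 := by ring
      rw [e1, e2]; linarith
    exact_mod_cast h4
  have hk := key (2 * D)
  rw [hbox, hbox] at hk
  have hpos : 0 < (2 * (2 * D) + 1) ^ D := by positivity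
  have : G.card * (2 * (2 * D) + 1) ^ D ≤ (2 * e * K) * (2 * (2 * D) + 1) ^ D :=
    hk.trans ((Nat.mul_le_mul_left _ hr).trans (le_of_eq (by ring)))
  exact absurd (Nat.le_of_mul_le_mul_right this hpos) (by omega)

lemma sign_count {m : ℕ} (hm : 0 < m) (t : ℝ) (ht : 0 < t) (x : Fin m → ℤ)
    (hx : ∀ j, x j = 1 ∨ x j = -1) :
    (((Fintype.piFinset fun _ : Fin m => ({1, -1} : Finset ℤ)).filter
      (fun y => t < |((x ⬝ᵥ y : ℤ) : ℝ)|)).card : ℝ) ≤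
      2 * 2 ^ m * Real.exp (-(t ^ 2 / (2 * m))) := by
  classical
  set Ω := Fintype.piFinset fun _ : Fin m => ({1, -1} : Finset ℤ) with hΩ
  have hm' : (0:ℝ) < m := by exact_mod_cast hm
  have mgf : ∀ u : ℝ, ∑ y ∈ Ω, Real.exp (u * ((x ⬝ᵥ y : ℤ) : ℝ)) = (2 * Real.cosh u) ^ m := by
    intro u
    have h1 : ∀ y : Fin m → ℤ, Real.exp (u * ((x ⬝ᵥ y : ℤ) : ℝ)) =
        ∏ j, Real.exp (u * ((x j : ℝ) * (y j : ℝ))) := by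
      intro y
      rw [← Real.exp_sum]
      simp [dotProduct, Finset.mul_sum]
    simp only [h1]
    rw [hΩ, ← Finset.prod_univ_sum (fun _ : Fin m => ({1, -1} : Finset ℤ))
      (fun j s => Real.exp (u * ((x j : ℝ) * (s : ℝ))))]
    have h2 : ∀ j : Fin m, ∑ s ∈ ({1, -1} : Finset ℤ), Real.exp (u * ((x j : ℝ) * (s : ℝ))) =
        2 * Real.cosh u := by
      intro j
      rw [Finset.sum_pair (by norm_num), Real.cosh_eq]
      rcases hx j with h | h <;> simp [h] <;> ring
    simp [h2]
  have mgf' : ∀ u : ℝ, ∑ y ∈ Ω, Real.exp (u * ((x ⬝ᵥ y : ℤ) : ℝ)) ≤ 2 ^ m * Real.exp (m * (u ^ 2 / 2)) := by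
    intro u
    rw [mgf, mul_pow, Real.exp_nat_mul]
    have := Real.cosh_le_exp_half_sq u
    have h0 := (Real.cosh_pos u).le
    gcongr
  set u := t / m with hu
  have hu0 : 0 < u := by positivity
  calc ((Ω.filter (fun y => t < |((x ⬝ᵥ y : ℤ) : ℝ)|)).card : ℝ)
      = ∑ y ∈ Ω.filter (fun y => t < |((x ⬝ᵥ y : ℤ) : ℝ)|), (1:ℝ) := by simp
    _ ≤ ∑ y ∈ Ω.filter (fun y => t < |((x ⬝ᵥ y : ℤ) : ℝ)|), Real.exp (-(u * t)) *
          (Real.exp (u * ((x ⬝ᵥ y : ℤ) : ℝ)) + Real.exp (-u * ((x ⬝ᵥ y : ℤ) : ℝ))) := by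
        refine Finset.sum_le_sum fun y hy => ?_
        have hy := (Finset.mem_filter.1 hy).2
        rw [mul_add, ← Real.exp_add, ← Real.exp_add]
        rcases lt_abs.1 hy with h | h
        · have : 1 ≤ Real.exp (-(u * t) + u * ((x ⬝ᵥ y : ℤ) : ℝ)) := by
            apply Real.one_le_exp; nlinarith
          linarith [Real.exp_pos (-(u * t) + -u * ((x ⬝ᵥ y : ℤ) : ℝ))]
        · have : 1 ≤ Real.exp (-(u * t) + -u * ((x ⬝ᵥ y : ℤ) : ℝ)) := by
            apply Real.one_le_exp; nlinarith
          linarith [Real.exp_pos (-(u * t) + u * ((x ⬝ᵥ y : ℤ) : ℝ))]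
    _ ≤ ∑ y ∈ Ω, Real.exp (-(u * t)) *
          (Real.exp (u * ((x ⬝ᵥ y : ℤ) : ℝ)) + Real.exp (-u * ((x ⬝ᵥ y : ℤ) : ℝ))) := by
        apply Finset.sum_le_sum_of_subset_of_nonneg (Finset.filter_subset _ _)
        intros; positivity
    _ = Real.exp (-(u * t)) * (∑ y ∈ Ω, Real.exp (u * ((x ⬝ᵥ y : ℤ) : ℝ)) +
          ∑ y ∈ Ω, Real.exp (-u * ((x ⬝ᵥ y : ℤ) : ℝ))) := by
        rw [← Finset.mul_sum, Finset.sum_add_distrib]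
    _ ≤ Real.exp (-(u * t)) * (2 ^ m * Real.exp (m * (u ^ 2 / 2)) + 2 ^ m * Real.exp (m * ((-u) ^ 2 / 2))) := by
        gcongr
        · exact mgf' u
        · exact mgf' (-u)
    _ = 2 * 2 ^ m * (Real.exp (-(u * t)) * Real.exp (m * (u ^ 2 / 2))) := by rw [neg_sq]; ring
    _ = _ := by
        rw [← Real.exp_add]
        congr 2
        rw [hu]; field_simp; ring

lemma exists_code {m : ℕ} (hm : 0 < m) (t : ℝ) (ht : 0 < t) (htm : t < m) :
    ∃ G : Finset (Fin m → ℤ), (∀ x ∈ G, ∀ j, x j = 1 ∨ x j = -1) ∧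
      (∀ x ∈ G, ∀ y ∈ G, x ≠ y → |((x ⬝ᵥ y : ℤ) : ℝ)| ≤ t) ∧
      Real.exp (t ^ 2 / (2 * m)) / 2 ≤ G.card := by
  classical
  set Ω := Fintype.piFinset fun _ : Fin m => ({1, -1} : Finset ℤ) with hΩ
  have hmem : ∀ x, x ∈ Ω ↔ ∀ j, x j = 1 ∨ x j = -1 := by
    intro x; simp [hΩ, Fintype.mem_piFinset]
  let P : Finset (Finset (Fin m → ℤ)) := Ω.powerset.filter
    (fun G => ∀ x ∈ G, ∀ y ∈ G, x ≠ y → |((x ⬝ᵥ y : ℤ) : ℝ)| ≤ t)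
  obtain ⟨G, hGP, hmax⟩ := Finset.exists_max_image P Finset.card ⟨∅, by simp [P]⟩
  have hG1 := Finset.mem_powerset.1 (Finset.mem_filter.1 hGP).1
  have hG2 := (Finset.mem_filter.1 hGP).2
  refine ⟨G, fun x hx => (hmem x).1 (hG1 hx), hG2, ?_⟩
  have hcover : Ω ⊆ G.biUnion (fun x => Ω.filter (fun y => t < |((x ⬝ᵥ y : ℤ) : ℝ)|)) := by
    intro y hy
    simp only [Finset.mem_biUnion, Finset.mem_filter]
    by_cases hyG : y ∈ G
    · refine ⟨y, hyG, hy, ?_⟩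
      have : y ⬝ᵥ y = m := by
        have h1 : ∀ j, y j * y j = 1 := by
          intro j
          rcases (hmem y).1 hy j with h | h <;> simp [h]
        simp [dotProduct, h1]
      rw [this]
      simpa using htm
    · by_contra! hno
      have hin : insert y G ∈ P := by
        simp only [P, Finset.mem_filter, Finset.mem_powerset]
        refine ⟨Finset.insert_subset hy hG1, ?_⟩
        intro a ha b hb hab
        rcases Finset.mem_insert.1 ha with rfl | ha'
        · rcases Finset.mem_insert.1 hb with rfl | hb'
          · exact absurd rfl hab
          · rw [dotProduct_comm]; exact hno b hb' hy
        · rcases Finset.mem_insert.1 hb with rfl | hb'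
          · exact hno a ha' hy
          · exact hG2 a ha' b hb' hab
      have := hmax _ hin
      rw [Finset.card_insert_of_notMem hyG] at this
      omega
  have hcΩ : (Ω.card : ℝ) = 2 ^ m := by
    have : Ω.card = 2 ^ m := by
      rw [hΩ, Fintype.card_piFinset]
      simp
    exact_mod_cast this
  have hc : (2:ℝ) ^ m ≤ G.card * (2 * 2 ^ m * Real.exp (-(t ^ 2 / (2 * m)))) := by
    rw [← hcΩ]
    calc (Ω.card : ℝ) ≤ ∑ x ∈ G, ((Ω.filter (fun y => t < |((x ⬝ᵥ y : ℤ) : ℝ)|)).card : ℝ) := by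
          exact_mod_cast (Finset.card_le_card hcover).trans Finset.card_biUnion_le
      _ ≤ ∑ x ∈ G, (2 * 2 ^ m * Real.exp (-(t ^ 2 / (2 * m)))) :=
          Finset.sum_le_sum fun x hx => sign_count hm t ht x ((hmem x).1 (hG1 hx))
      _ = _ := by rw [hcΩ]; simp
  rw [Real.exp_neg] at hc
  have he := Real.exp_pos (t ^ 2 / (2 * m))
  have h2 : (0:ℝ) < 2 ^ m := by positivity
  have h3 : (2:ℝ) ^ m * 1 ≤ 2 ^ m * (G.card * 2 * (Real.exp (t ^ 2 / (2 * m)))⁻¹) := by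
    linarith [hc]
  have h4 := le_of_mul_le_mul_left h3 h2
  rw [← div_eq_mul_inv, le_div_iff₀ he] at h4
  linarith

/-- `Z + e_i xᵀ` -/
def bump {m e : ℕ} (Z : Fin e → Fin m → ℤ) (i : Fin e) (x : Fin m → ℤ) : Fin e → Fin m → ℤ :=
  Z + Pi.single i x

lemma single_diff {m e : ℕ} (Z : Fin e → Fin m → ℤ) (i l : Fin e) (x y : Fin m → ℤ) :
    (bump Z i x l - Z l) ⬝ᵥ y = if l = i then x ⬝ᵥ y else 0 := by
  by_cases h : l = i
  · subst h; simp [bump]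
  · simp [bump, h]

lemma core {k m e K : ℕ} (φ : Fin k ≃ Fin m ⊕ Fin e) (he : 0 < e) (hm : 0 < m) (t : ℝ)
    (ht : 0 < t) (G : Finset (Fin m → ℤ)) (hG1 : ∀ x ∈ G, ∀ j, x j = 1 ∨ x j = -1)
    (hG2 : ∀ x ∈ G, ∀ y ∈ G, x ≠ y → |((x ⬝ᵥ y : ℤ) : ℝ)| ≤ t)
    (hN : 2 * e * K < G.card)
    (c : Finset (Fin k → ℝ) → Finset (Fin k → ℝ)) (hc1 : ∀ V, c V ⊆ V)
    (hc2 : ∀ V, (c V).card ≤ K) :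
    ∃ (p : ℕ) (V : Fin p → Finset (Fin k → ℝ)),
      ∃ S₀ ⊆ Finset.univ.biUnion V, S₀.card = k ∧
        ((m : ℝ) ^ e) ^ 2 ≤ detk k (∑ v ∈ S₀, outer v) ∧
        (∀ S ⊆ Finset.univ.biUnion V, S.card = k →
          detk k (∑ v ∈ S, outer v) ≤ detk k (∑ v ∈ S₀, outer v)) ∧
        (∀ T ⊆ Finset.univ.biUnion (fun i => c (V i)), T.card = k →
          detk k (∑ v ∈ T, outer v) ≤ ((k : ℝ) ^ m * t ^ e) ^ 2) := by
  classical
  have hk : m + e = k := by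
    have := Fintype.card_congr φ
    simpa using this.symm
  have hGabs : ∀ x ∈ G, ∀ j, |x j| ≤ 1 := by
    intro x hx j
    rcases hG1 x hx j with h | h <;> simp [h]
  let W : (Fin e → Fin m → ℤ) → Finset (Fin k → ℝ) := fun Z => G.image (svec φ Z)
  let L : (Fin e → Fin m → ℤ) → Finset (Fin m → ℤ) := fun Z =>
    G.filter (fun y => svec φ Z y ∈ c (W Z))
  have hL : ∀ Z, (L Z).card ≤ K := by
    intro Z
    refine le_trans ?_ (hc2 (W Z))
    apply Finset.card_le_card_of_injOn (svec φ Z)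
    · intro y hy
      exact (Finset.mem_filter.1 hy).2
    · exact (svec_inj φ Z).injOn
  obtain ⟨Z, hZ⟩ : ∃ Z : Fin e → Fin m → ℤ, ∀ i, ∃ x ∈ G, x ∉ L (bump Z i x) :=
    averaging G hGabs K L hL hN
  choose x hxG hxL using hZ
  let V0 : Finset (Fin k → ℝ) := Finset.univ.image fun j : Fin m => svec φ Z (Pi.single j 1)
  let V : Fin (e + 1) → Finset (Fin k → ℝ) :=
    Fin.cons V0 (fun i => W (bump Z i (x i)))
  -- the good solution
  have hgood : ∃ S ⊆ Finset.univ.biUnion V, S.card = k ∧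
      detk k (∑ v ∈ S, outer v) = ((m : ℝ) ^ e) ^ 2 := by
    let Y : Fin m ⊕ Fin e → Fin m → ℤ := Sum.elim (fun j => Pi.single j 1) x
    let Z' : Fin m ⊕ Fin e → Fin e → Fin m → ℤ :=
      Sum.elim (fun _ => Z) (fun i => bump Z i (x i))
    let v : Fin k → Fin k → ℝ := fun r => svec φ (Z' (φ r)) (Y (φ r))
    have hdet : (Matrix.of v).det = (m : ℝ) ^ e := by
      have h1 := det_shear_eq φ Z (fun r => Y (φ r)) (fun r => Z' (φ r))
      simp only [Equiv.apply_symm_apply] at h1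
      rw [show Matrix.of v = Matrix.of (fun r => svec φ (Z' (φ r)) (Y (φ r))) from rfl, h1]
      have h2 : (Matrix.of fun r => srow (Y r) (fun l => (Z' r l - Z l) ⬝ᵥ Y r)) =
          Matrix.fromBlocks (1 : Matrix (Fin m) (Fin m) ℝ) 0
            (Matrix.of fun i j => (x i j : ℝ)) (Matrix.diagonal fun _ : Fin e => (m : ℝ)) := by
        ext r s
        rcases r with j | i <;> rcases s with j' | l
        · simp only [Y, srow, Matrix.of_apply, Sum.elim_inl, Matrix.fromBlocks_apply₁₁,
            Matrix.one_apply, Pi.single_apply]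
          simp [eq_comm]
        · simp [Y, Z', srow]
        · simp [Y, Z', srow]
        · simp only [Y, Z', srow, Matrix.of_apply, Sum.elim_inr, Matrix.fromBlocks_apply₂₂,
            Matrix.diagonal_apply]
          rw [single_diff]
          have hxx : x i ⬝ᵥ x i = m := by
            have h1 : ∀ j, x i j * x i j = 1 := by
              intro j
              rcases hG1 _ (hxG i) j with h | h <;> simp [h]
            simp [dotProduct, h1]
          rw [hxx]
          by_cases h : l = i
          · simp [h]
          · simp [h, Ne.symm h]
      rw [h2, Matrix.det_fromBlocks_zero₁₂]
      simp
    have hinj : Function.Injective v := by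
      intro a b hab
      by_contra hne
      have : (Matrix.of v).det = 0 := Matrix.det_zero_of_row_eq hne hab
      rw [hdet] at this
      have hm' : (m : ℝ) ≠ 0 := by exact_mod_cast hm.ne'
      exact pow_ne_zero e hm' this
    refine ⟨Finset.univ.image v, ?_, ?_, ?_⟩
    · intro w hw
      obtain ⟨r, _, rfl⟩ := Finset.mem_image.1 hw
      simp only [Finset.mem_biUnion, Finset.mem_univ, true_and]
      simp only [v]
      rcases φ r with j | i
      · exact ⟨0, by simp only [V, Fin.cons_zero]; exact Finset.mem_image_of_mem _ (Finset.mem_univ j)⟩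
      · exact ⟨i.succ, by simp only [V, Fin.cons_succ]; exact Finset.mem_image_of_mem _ (hxG i)⟩
    · rw [Finset.card_image_of_injective _ hinj]; simp
    · rw [detk_image v hinj _ rfl, hdet]
  obtain ⟨S1, hS1, hS1c, hS1d⟩ := hgood
  obtain ⟨S₀, hS₀, hmax⟩ := Finset.exists_max_image
    (Finset.powersetCard k (Finset.univ.biUnion V)) (fun S => detk k (∑ v ∈ S, outer v))
    ⟨S1, Finset.mem_powersetCard.2 ⟨hS1, hS1c⟩⟩
  obtain ⟨hS₀1, hS₀2⟩ := Finset.mem_powersetCard.1 hS₀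
  refine ⟨e + 1, V, S₀, hS₀1, hS₀2, ?_, ?_, ?_⟩
  · rw [← hS1d]; exact hmax S1 (Finset.mem_powersetCard.2 ⟨hS1, hS1c⟩)
  · intro S hS hSc
    exact hmax S (Finset.mem_powersetCard.2 ⟨hS, hSc⟩)
  · intro T hT hTc
    obtain ⟨v, hv, rfl⟩ := exists_enum T hTc
    rw [detk_image v hv _ rfl]
    have hrow : ∀ r, ∃ (Y : Fin m → ℤ) (Z' : Fin e → Fin m → ℤ) (i : Fin e),
        v r = svec φ Z' Y ∧ (∀ j, |(Y j : ℝ)| ≤ 1) ∧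
        (∀ l, l ≠ i → (Z' l - Z l) ⬝ᵥ Y = 0) ∧
        (∀ l, |(((Z' l - Z l) ⬝ᵥ Y : ℤ) : ℝ)| ≤ t) := by
      intro r
      have hr := hT (Finset.mem_image_of_mem v (Finset.mem_univ r))
      simp only [Finset.mem_biUnion, Finset.mem_univ, true_and] at hr
      obtain ⟨a, ha⟩ := hr
      induction a using Fin.cases with
      | zero =>
        have ha' := hc1 _ ha
        simp only [V, Fin.cons_zero] at ha'
        obtain ⟨j, _, hj⟩ := Finset.mem_image.1 ha'
        refine ⟨Pi.single j 1, Z, ⟨0, he⟩, hj.symm, ?_, ?_, ?_⟩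
        · intro j'
          by_cases h : j' = j
          · subst h; simp
          · simp [h]
        · intro l _; simp
        · intro l; simp [ht.le]
      | succ i =>
        have ha' := hc1 _ ha
        simp only [V, Fin.cons_succ] at ha ha'
        obtain ⟨y, hy, hj⟩ := Finset.mem_image.1 ha'
        have hne : x i ≠ y := by
          rintro rfl
          apply hxL i
          simp only [L, Finset.mem_filter]
          refine ⟨hy, ?_⟩
          rw [hj]; exact ha
        refine ⟨y, bump Z i (x i), i, hj.symm, ?_, ?_, ?_⟩
        · intro j
          exact_mod_cast hGabs y hy j
        · intro l hl
          rw [single_diff, if_neg hl]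
        · intro l
          rw [single_diff]
          split_ifs with h
          · exact hG2 _ (hxG i) _ hy hne
          · simp [ht.le]
    choose Y Z' ι hveq hY h0 hbd using hrow
    have hve : Matrix.of v = Matrix.of (fun r => svec φ (Z' r) (Y r)) := by
      congr 1; funext r; exact hveq r
    rw [hve, det_shear_eq φ Z]
    have hb := det_bound_aux (Matrix.of fun r => srow (Y (φ.symm r))
      (fun l => (Z' (φ.symm r) l - Z l) ⬝ᵥ Y (φ.symm r))) t (fun r => ι (φ.symm r))
      (fun r j => by simpa [srow] using hY (φ.symm r) j)
      (fun r l hl => by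
        have := h0 (φ.symm r) l hl
        simp only [srow, Matrix.of_apply, Sum.elim_inr]
        exact_mod_cast this)
      (fun r l => by
        have := hbd (φ.symm r) l
        simp only [srow, Matrix.of_apply, Sum.elim_inr]
        exact this)
    rw [hk] at hb
    rw [← sq_abs]
    exact pow_le_pow_left₀ (abs_nonneg _) hb 2

lemma numeric (β : ℝ) (hβ : 1 ≤ β) : ∃ k₀ : ℕ, ∀ k : ℕ, k₀ ≤ k →
    4 ≤ k ∧ 4 ≤ Real.log k ∧ 8 * β * Real.log k ^ 2 < k ∧ Real.log k ≤ k := by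
  have h1 : ∀ᶠ k : ℕ in Filter.atTop, 4 ≤ Real.log k :=
    (Real.tendsto_log_atTop.comp tendsto_natCast_atTop_atTop).eventually_ge_atTop 4
  have h2 : ∀ᶠ x : ℝ in Filter.atTop, ‖Real.log x ^ 2‖ ≤ (1 / (16 * β)) * ‖x‖ :=
    (Real.isLittleO_pow_log_id_atTop (n := 2)).bound (by positivity)
  have h2' : ∀ᶠ k : ℕ in Filter.atTop, ‖Real.log (k:ℝ) ^ 2‖ ≤ (1 / (16 * β)) * ‖(k:ℝ)‖ :=
    tendsto_natCast_atTop_atTop.eventually h2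
  obtain ⟨k₀, hk₀⟩ := Filter.eventually_atTop.1 ((h1.and h2').and (Filter.eventually_ge_atTop 4))
  refine ⟨k₀, fun k hk => ?_⟩
  obtain ⟨⟨a, b⟩, d⟩ := hk₀ k hk
  have hkp : (0:ℝ) < k := by exact_mod_cast (by omega : 0 < k)
  refine ⟨d, a, ?_, (Real.log_le_sub_one_of_pos hkp).trans (by linarith)⟩
  rw [Real.norm_of_nonneg (by positivity), Real.norm_of_nonneg hkp.le, one_div,
    ← div_eq_inv_mul, le_div_iff₀ (by positivity)] at b
  nlinarith

set_option maxHeartbeats 2000000 in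
theorem coreset_lower_bound_for_determinant_maximization :
    ∃ C > (0:ℝ), ∀ β : ℝ, 1 ≤ β → ∃ k₀ : ℕ, ∀ k : ℕ, k₀ ≤ k →
      ∀ c : Finset (Fin k → ℝ) → Finset (Fin k → ℝ),
        (∀ V, c V ⊆ V) →
        (∀ V, ((c V).card : ℝ) ≤ (k:ℝ) ^ β) →
        ∃ (p : ℕ) (V : Fin p → Finset (Fin k → ℝ)),
          ∃ S₀ ⊆ Finset.univ.biUnion V, S₀.card = k ∧
            0 < detk k (∑ v ∈ S₀, outer v) ∧
            (∀ S ⊆ Finset.univ.biUnion V, S.card = k →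
              detk k (∑ v ∈ S, outer v) ≤ detk k (∑ v ∈ S₀, outer v)) ∧
            (∀ T ⊆ Finset.univ.biUnion (fun i => c (V i)), T.card = k →
              detk k (∑ v ∈ T, outer v) ≤
                (C * β * (Real.log k) ^ 2 / k) ^ (k - ⌈(k:ℝ) / Real.log k⌉₊) *
                  detk k (∑ v ∈ S₀, outer v)) := by
  refine ⟨8 * Real.exp 8, by positivity, fun β hβ => ?_⟩
  obtain ⟨k₀, hk₀⟩ := numeric β hβ
  refine ⟨k₀, fun k hk c hc1 hc2 => ?_⟩
  obtain ⟨hk4, hL4, hbig, hLk⟩ := hk₀ k hk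
  set L := Real.log k with hLdef
  set m := ⌈(k:ℝ) / L⌉₊ with hmdef
  have hk4' : (4:ℝ) ≤ k := by exact_mod_cast hk4
  have hkpos : (0:ℝ) < k := by linarith
  have hLpos : 0 < L := by linarith
  have hm1 : (k:ℝ) / L ≤ m := Nat.le_ceil _
  have hm2 : (m:ℝ) < k / L + 1 := Nat.ceil_lt_add_one (by positivity)
  have hmpos' : (0:ℝ) < m := lt_of_lt_of_le (by positivity) hm1
  have hmpos : 0 < m := by exact_mod_cast hmpos'
  have hkL4 : (k:ℝ) / L ≤ k / 4 := by gcongr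
  have hmhalf : (m:ℝ) ≤ k / 2 := by linarith
  have hmk : m ≤ k := by
    have : (m:ℝ) ≤ k := by linarith
    exact_mod_cast this
  set e := k - m with hedef
  have hke : m + e = k := by omega
  have hke' : (m:ℝ) + e = k := by exact_mod_cast hke
  have hehalf : (k:ℝ) / 2 ≤ e := by linarith
  have hepos : 0 < e := by
    have : (0:ℝ) < e := by linarith
    exact_mod_cast this
  have hmL : (m:ℝ) * L ≤ 2 * k := by
    have h1 : (m:ℝ) * L ≤ (k / L + 1) * L := by gcongr
    have h2 : ((k:ℝ) / L + 1) * L = k + L := by field_simp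
    linarith
  have hkmL : (k:ℝ) ≤ m * L := by rwa [div_le_iff₀ hLpos] at hm1
  set t := Real.sqrt (2 * m * ((β + 3) * L)) with htdef
  have htsq : t ^ 2 = 2 * m * ((β + 3) * L) := Real.sq_sqrt (by positivity)
  have htpos : 0 < t := Real.sqrt_pos.2 (by positivity)
  have htsq' : t ^ 2 ≤ 8 * β * L * m := by
    rw [htsq]
    have : 0 < (m:ℝ) * L := by positivity
    nlinarith
  have htm : t < m := by
    apply lt_of_pow_lt_pow_left₀ 2 hmpos'.le
    have h1 : 8 * β * L < m := by
      have : (8 * β * L) * L < m * L := by nlinarith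
      exact lt_of_mul_lt_mul_right this hLpos.le
    nlinarith
  obtain ⟨G, hG1, hG2, hG3⟩ := exists_code hmpos t htpos htm
  have hexp : Real.exp (t ^ 2 / (2 * m)) = (k:ℝ) ^ β * (k:ℝ) ^ 3 := by
    have h1 : t ^ 2 / (2 * m) = (β + 3) * L := by
      rw [htsq]; field_simp
    rw [h1, Real.rpow_def_of_pos hkpos, ← Real.exp_log (pow_pos hkpos 3), ← Real.exp_add,
      Real.log_pow, hLdef]
    congr 1
    push_cast
    ring
  rw [hexp] at hG3
  set K := ⌊(k:ℝ) ^ β⌋₊ with hKdef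
  have hKb : (0:ℝ) < (k:ℝ) ^ β := Real.rpow_pos_of_pos hkpos β
  have hK : (K:ℝ) ≤ (k:ℝ) ^ β := Nat.floor_le hKb.le
  have hN : 2 * e * K < G.card := by
    have hek : (e:ℝ) ≤ k := by linarith
    have h1 : (2:ℝ) * e * K ≤ 2 * k * (k:ℝ) ^ β := by gcongr
    have h2 : 2 * (k:ℝ) < k ^ 3 / 2 := by nlinarith [mul_pos hkpos hkpos]
    have h3 : 2 * (k:ℝ) * (k:ℝ) ^ β < k ^ 3 / 2 * (k:ℝ) ^ β := by gcongr
    have h4 : (2:ℝ) * e * K < G.card := by linarith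
    exact_mod_cast h4
  let φ : Fin k ≃ Fin m ⊕ Fin e := (finCongr hke.symm).trans finSumFinEquiv.symm
  obtain ⟨p, V, S₀, hS1, hS2, hS3, hS4, hS5⟩ := core φ hepos hmpos t htpos G hG1 hG2 hN c hc1
    (fun W => Nat.le_floor (hc2 W))
  refine ⟨p, V, S₀, hS1, hS2, lt_of_lt_of_le (by positivity) hS3, hS4, fun T hT hTc => ?_⟩
  refine (hS5 T hT hTc).trans ?_
  have hfac : (0:ℝ) ≤ (8 * Real.exp 8 * β * L ^ 2 / k) ^ e := by positivity
  refine le_trans ?_ (mul_le_mul_of_nonneg_left hS3 hfac)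
  -- the numerical inequality
  have hA : ((k:ℝ) ^ m) ^ 2 ≤ Real.exp 8 ^ e := by
    have h1 : (k:ℝ) = Real.exp L := (Real.exp_log hkpos).symm
    rw [← pow_mul, ← Real.exp_nat_mul]
    calc (k:ℝ) ^ (m * 2) = Real.exp ((m * 2 : ℕ) * L) := by
          rw [Real.exp_nat_mul, ← h1]
      _ ≤ Real.exp (e * 8) := by
          apply Real.exp_le_exp.2
          push_cast
          nlinarith
  have hB : t ^ 2 ≤ (8 * β * L ^ 2 / k) * (m:ℝ) ^ 2 := by
    refine htsq'.trans ?_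
    rw [div_mul_eq_mul_div, le_div_iff₀ hkpos]
    have : 8 * β * L * m * k ≤ 8 * β * L * m * (m * L) := by gcongr
    linarith
  calc ((k:ℝ) ^ m * t ^ e) ^ 2 = ((k:ℝ) ^ m) ^ 2 * (t ^ 2) ^ e := by ring
    _ ≤ Real.exp 8 ^ e * ((8 * β * L ^ 2 / k) * (m:ℝ) ^ 2) ^ e := by gcongr
    _ = (8 * Real.exp 8 * β * L ^ 2 / k) ^ e * ((m:ℝ) ^ e) ^ 2 := by
        rw [← mul_pow, ← pow_mul, mul_comm e 2, pow_mul, ← mul_pow]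
        congr 1
        ring
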